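/- arXiv:2602.02200 — 2 statements merged into one kernel-verified Lean document; each statement's English description precedes it below -/
import Mathlib

section
/- Let m ∈ ℕ. Every polynomial p ∈ P_m admits a decomposition p = h + η₊²·q with h ∈ H_m and q ∈ P_{m−2}, and this decomposition is unique: if h + η₊²·q = h' + η₊²·q' with h, h' ∈ H_m and q, q' ∈ P_{m−2}, then h = h' and q = q'. Equivalently, P_m is the internal direct sum of H_m and η₊²·P_{m−2}. -/
open MvPolynomial

noncomputable section

/-- The polynomial ring ℝ[x,y,t], with x = X 0, y = X 1, t = X 2. -/
abbrev R3 := MvPolynomial (Fin 3) ℝ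

/-- The weights w(x) = w(y) = 1, w(t) = 2. -/
def w3 : Fin 3 → ℤ := ![1, 1, 2]

/-- The horizontal vector field X p = ∂ₓ p + 2 y ∂ₜ p. -/
def Xop : R3 →ₗ[ℝ] R3 :=
  (pderiv (0 : Fin 3)).toLinearMap +
    (LinearMap.mulLeft ℝ ((2 : R3) * X 1)) ∘ₗ (pderiv (2 : Fin 3)).toLinearMap

/-- The horizontal vector field Y p = ∂_y p − 2 x ∂ₜ p. -/
def Yop : R3 →ₗ[ℝ] R3 :=
  (pderiv (1 : Fin 3)).toLinearMap -
    (LinearMap.mulLeft ℝ ((2 : R3) * X 0)) ∘ₗ (pderiv (2 : Fin 3)).toLinearMap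

/-- The Heisenberg sub-Laplacian Δ_H = X² + Y². -/
def ΔH : R3 →ₗ[ℝ] R3 := Xop ∘ₗ Xop + Yop ∘ₗ Yop

/-- P_m : weighted homogeneous polynomials of degree m (ℤ-indexed, so P_m = 0 for m < 0). -/
def Pm (m : ℤ) : Submodule ℝ R3 := weightedHomogeneousSubmodule ℝ w3 m

/-- H_m : weighted homogeneous Δ_H-harmonic polynomials of degree m. -/
def Hm (m : ℤ) : Submodule ℝ R3 := Pm m ⊓ LinearMap.ker ΔH

/-- The polynomial gauge η₊² = x² + y² + 4t. -/
def etaSq : R3 := X 0 ^ 2 + X 1 ^ 2 + 4 * X 2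

/-- falling factorial -/
def ff : ℕ → ℂ → ℂ
  | 0, _ => 1
  | (j+1), x => (x - j) * ff j x

lemma ff_shift (j : ℕ) (x : ℂ) : ff (j+1) (x+1) = (x+1) * ff j x := by
  induction j with
  | zero => simp [ff]
  | succ j ih =>
    rw [ff, ih, ff]; push_cast; ring

lemma ff_nat (j n : ℕ) : ff j (n:ℂ) = (n.descFactorial j : ℂ) := by
  induction j with
  | zero => simp [ff]
  | succ j ih =>
    rw [ff, ih, Nat.descFactorial_succ]
    rcases le_or_gt j n with h | h
    · push_cast [Nat.cast_sub h]; ring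
    · rw [Nat.descFactorial_of_lt h]; simp

/-- the universal coefficients -/
def bb (k : ℕ) (c : ℂ) : ℕ → ℂ
  | 0 => 1
  | 1 => c / (k+1)
  | (j+2) => (c * bb k c (j+1) - bb k c j) / ((j+2) * (j+2+k))

lemma bb_rec (k : ℕ) (c : ℂ) (j : ℕ) :
    ((j:ℂ)+2) * (j+2+k) * bb k c (j+2) = c * bb k c (j+1) - bb k c j := by
  have h : ((j:ℂ)+2) * (j+2+k) ≠ 0 := by norm_cast; positivity
  rw [bb, mul_div_cancel₀ _ h]

lemma bb_one (k : ℕ) (c : ℂ) : ((k:ℂ)+1) * bb k c 1 = c := by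
  have h : ((k:ℂ)+1) ≠ 0 := by norm_cast
  rw [bb, mul_div_cancel₀ _ h]

def SS (k : ℕ) (c s x : ℂ) (N : ℕ) : ℂ := ∑ j ∈ Finset.range N, ff j x * bb k c j * s ^ j

lemma SS_rec (k : ℕ) (c s x : ℂ) (M : ℕ) :
    (k + x + 2) * SS k c s (x+2) (M+1) - (2*x+3+k+c*s) * SS k c s (x+1) (M+1)
      + (x+1)*(1+s^2) * SS k c s x (M+1)
    = - ff M (x+1) * (M+1) * (M+1+k) * bb k c (M+1) * s^(M+1)
      + ff (M+1) (x+1) * bb k c M * s^(M+2) := by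
  induction M with
  | zero =>
    have := bb_one k c
    simp only [SS, zero_add, Finset.sum_range_one, ff, pow_zero, pow_one]
    have h0 : bb k c 0 = 1 := rfl
    rw [h0]; push_cast
    linear_combination s * this
  | succ M ih =>
    have e1 : ff (M+1) (x+2) = (x+2) * ff M (x+1) := by
      have := ff_shift M (x+1)
      rwa [show x + 1 + 1 = x + 2 by ring] at this
    have e2 : ff (M+1) (x+1) = (x+1-M) * ff M (x+1) := by rw [ff]
    have e3 : (x+1) * ff (M+1) x = (x-M) * ((x+1-M) * ff M (x+1)) := by
      rw [← ff_shift, ff, ff]; push_cast; ring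
    have e4 : ff (M+2) (x+1) = (x-M) * ((x+1-M) * ff M (x+1)) := by
      rw [ff, ff]; push_cast; ring
    have hb := bb_rec k c M
    have hS : ∀ y, SS k c s y (M+1+1) = SS k c s y (M+1) + ff (M+1) y * bb k c (M+1) * s^(M+1) := by
      intro y; rw [SS, Finset.sum_range_succ]; rfl
    rw [hS, hS, hS]
    rw [e2] at ih
    rw [e1, e2, e4]
    push_cast
    linear_combination ih + (1+s^2) * bb k c (M+1) * s^(M+1) * e3 + (x+1-M) * ff M (x+1) * s^(M+2) * hb

lemma SS_stable (k : ℕ) (c s : ℂ) (n N : ℕ) (h : n + 1 ≤ N) :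
    SS k c s n N = SS k c s n (n+1) := by
  unfold SS
  symm
  apply Finset.sum_subset
  · intro j; simp; omega
  · intro j _ hj
    simp at hj
    rw [ff_nat, Nat.descFactorial_of_lt (by omega)]; simp

def FF (k : ℕ) (c s : ℂ) (n : ℕ) : ℂ := SS k c s n (n+1)

lemma FF_rec (k : ℕ) (c s : ℂ) (n : ℕ) :
    ((k:ℂ) + n + 2) * FF k c s (n+2) = (2*n+3+k+c*s) * FF k c s (n+1)
      - (n+1)*(1+s^2) * FF k c s n := by
  have h := SS_rec k c s n (n+2)
  have z : ∀ j, n + 1 < j → ff j ((n:ℂ)+1) = 0 := by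
    intro j hj
    have := ff_nat j (n+1)
    push_cast at this
    rw [this, Nat.descFactorial_of_lt hj]; simp
  rw [z _ (by omega), z _ (by omega)] at h
  have h2 := SS_stable k c s (n+2) (n+2+1) (by omega)
  have h1 := SS_stable k c s (n+1) (n+2+1) (by omega)
  have h0 := SS_stable k c s n (n+2+1) (by omega)
  push_cast at h2 h1
  unfold FF
  push_cast
  rw [h1, h0] at h
  linear_combination h

lemma FF_zero (k : ℕ) (c s : ℂ) : FF k c s 0 = 1 := by simp [FF, SS, ff, bb]

lemma FF_one (k : ℕ) (c s : ℂ) : FF k c s 1 = 1 + c / (k+1) * s := by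
  simp [FF, SS, ff, bb, Finset.sum_range_succ]

lemma FF_ne_of_pos (k : ℕ) (r s : ℝ) (hr : r * s ≠ 0) (n : ℕ) :
    FF k (Complex.I * r) s n ≠ 0 := by
  have key : ∀ n, 0 < (r * s) * (FF k (Complex.I * r) s (n+1) * (starRingEnd ℂ) (FF k (Complex.I * r) s n)).im := by
    intro n
    induction n with
    | zero =>
      rw [zero_add, FF_zero, FF_one]
      have : (Complex.I * r / (k+1) * s : ℂ) = ((r * s / (k+1) : ℝ) : ℂ) * Complex.I := by
        push_cast; ring
      rw [this]
      simp only [map_one, mul_one, Complex.add_im, Complex.one_im, Complex.re_ofReal_mul, Complex.im_ofReal_mul, Complex.I_im, zero_add]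
      have : 0 < (r*s)^2 := by positivity
      have h2 : r * s * (r * s / (k+1)) = (r*s)^2 / (k+1) := by ring
      rw [h2]; positivity
    | succ n ih =>
      have h := FF_rec k (Complex.I * r) s n
      set u := FF k (Complex.I * r) s (n+1+1)
      set v := FF k (Complex.I * r) s (n+1)
      set w := FF k (Complex.I * r) s n
      change ((k:ℂ)+n+2) * u = _ at h
      have hre := congrArg Complex.re h
      have him := congrArg Complex.im h
      simp [pow_two] at hre him
      simp at ih ⊢
      have hv : 0 ≤ (r*s)^2 * (v.re^2 + v.im^2) := by positivity
      have hk : (0:ℝ) < k + n + 2 := by positivity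
      have e : (k + n + 2) * (r * s * (-(u.re * v.im) + u.im * v.re)) =
         (r*s)^2 * (v.re^2+v.im^2) + (n+1)*(1+s*s) * (r * s * (-(v.re * w.im) + v.im * w.re)) := by
        linear_combination r * s * v.re * him - r*s*v.im * hre
      have : 0 < (n+1)*(1+s*s) * (r * s * (-(v.re * w.im) + v.im * w.re)) := by
        have : 0 < ((n:ℝ)+1)*(1+s*s) := mul_pos (by positivity) (by nlinarith [mul_self_nonneg s])
        exact mul_pos this ih
      by_contra hc
      nlinarith
  intro h
  have := key n
  rw [h] at this
  simp at this

lemma bb_odd (i : ℕ) : bb 0 0 (2*i+1) = 0 := by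
  induction i with
  | zero => simp [bb]
  | succ i ih =>
    rw [show 2*(i+1)+1 = (2*i+1)+2 by ring, bb, ih]; simp

lemma bb_even (i : ℕ) : bb 0 0 (2*i) * 4^i * (i.factorial:ℂ)^2 = (-1)^i := by
  induction i with
  | zero => simp [bb]
  | succ i ih =>
    have h := bb_rec 0 0 (2*i)
    rw [show 2*(i+1) = 2*i+2 by ring, Nat.factorial_succ]
    push_cast at h ⊢
    linear_combination 4^i * (i.factorial:ℂ)^2 * h - ih

lemma term_even (n j : ℕ) : ∃ z : ℤ, ff (j+1) (n:ℂ) * bb 0 0 (j+1) * (-4)^(j+1) = 2 * z := by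
  rcases Nat.even_or_odd' (j+1) with ⟨i, hi | hi⟩
  · obtain ⟨l, rfl⟩ : ∃ l, i = l + 1 := ⟨i-1, by omega⟩
    refine ⟨(-1)^(l+1) * n.choose (2*(l+1)) * (l+1).centralBinom * 4^l * 2, ?_⟩
    rw [hi, ff_nat, Nat.descFactorial_eq_factorial_mul_choose]
    have h1 := bb_even (l+1)
    have h2 := Nat.choose_mul_factorial_mul_factorial (n := 2*(l+1)) (k := l+1) (by omega)
    rw [show 2*(l+1) - (l+1) = l+1 by omega, ← Nat.centralBinom_eq_two_mul_choose] at h2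
    have h3 : ((l+1).centralBinom : ℂ) * (l+1).factorial * (l+1).factorial = (2*(l+1)).factorial := by
      exact_mod_cast h2
    have h4 : (-4:ℂ)^(2*(l+1)) = 4^(l+1) * 4^(l+1) := by
      rw [pow_mul, ← mul_pow]; norm_num
    push_cast
    rw [h4, ← h3, ← h1]
    ring
  · refine ⟨0, ?_⟩
    rw [hi, bb_odd]; simp

lemma FF_ne_zero_case (n : ℕ) : FF 0 0 (-4) n ≠ 0 := by
  choose z hz using term_even n
  rw [FF, SS, Finset.sum_range_succ']
  simp_rw [hz]
  rw [← Finset.mul_sum]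
  simp only [ff, bb, pow_zero]
  intro h
  have h' : 2 * (∑ j ∈ Finset.range n, z j) + 1 = 0 := by
    have : ((2 * (∑ j ∈ Finset.range n, z j) + 1 : ℤ) : ℂ) = 0 := by
      push_cast; linear_combination h
    exact_mod_cast this
  omega

lemma seq_zero (k n : ℕ) (σ : ℝ) (hσ : σ ≠ 0) (d : ℕ → ℂ)
    (h1 : ∀ l, l + 1 = n → ((k:ℂ)+1) * d 1 = Complex.I * σ * k * (l+1) * d 0)
    (h2 : ∀ j l, j + 2 + l = n → ((j:ℂ)+2) * (j+2+k) * d (j+2) =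
      Complex.I * σ * k * (l+1) * d (j+1) - (l+2)*(l+1) * d j)
    (hs : ∑ j ∈ Finset.range (n+1), d j * (-4)^j = 0) : ∀ j ≤ n, d j = 0 := by
  set c : ℂ := Complex.I * ((σ * k : ℝ) : ℂ) with hc
  have hF : FF k c (-4) n ≠ 0 := by
    rcases Nat.eq_zero_or_pos k with rfl | hk
    · have : c = 0 := by simp [hc]
      rw [this]; exact FF_ne_zero_case n
    · have := FF_ne_of_pos k (σ*k) (-4) (by
        have : (k:ℝ) ≠ 0 := by positivity
        simp [hσ]; omega) n
      simpa [hc] using this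
  have hd : ∀ j, (j ≤ n → d j = d 0 * (ff j n * bb k c j)) ∧
      (j + 1 ≤ n → d (j+1) = d 0 * (ff (j+1) n * bb k c (j+1))) := by
    intro j
    induction j with
    | zero =>
      refine ⟨fun _ => by simp [ff, bb], fun h => ?_⟩
      have e := h1 (n-1) (by omega)
      have hb := bb_one k c
      have hn : ((n-1:ℕ):ℂ) = n - 1 := by push_cast [Nat.cast_sub (show 1 ≤ n by omega)]; ring
      rw [hn] at e
      have hk : ((k:ℂ)+1) ≠ 0 := by norm_cast
      apply mul_left_cancel₀ hk
      rw [hc] at hb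
      push_cast at hb
      simp only [ff, zero_add]
      rw [hc]; push_cast
      linear_combination e - d 0 * n * hb
    | succ j ih =>
      refine ⟨ih.2, fun h => ?_⟩
      have e := h2 j (n-(j+2)) (by omega)
      have hb := bb_rec k c j
      have hn : ((n-(j+2):ℕ):ℂ) = n - (j+2) := by push_cast [Nat.cast_sub (show j+2 ≤ n by omega)]; ring
      rw [hn, ih.1 (by omega), ih.2 (by omega)] at e
      have hk : ((j:ℂ)+2) * (j+2+k) ≠ 0 := by norm_cast; positivity
      apply mul_left_cancel₀ hk
      have f1 : ff (j+1+1) (n:ℂ) = (n-j-1) * ((n - j) * ff j n) := by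
        simp only [ff]; push_cast; ring
      have f2 : ff (j+1) (n:ℂ) = (n - j) * ff j n := by simp only [ff]
      rw [f2] at e
      rw [f1]
      rw [show j+1+1 = j+2 by ring]
      have hc' : c = Complex.I * σ * k := by rw [hc]; push_cast; ring
      rw [← hc'] at e
      linear_combination e - d 0 * ((n-j-1) * ((n - j) * ff j n)) * hb
  have h0 : d 0 * FF k c (-4) n = 0 := by
    rw [← hs, FF, SS, Finset.mul_sum]
    apply Finset.sum_congr rfl
    intro j hj
    rw [(hd j).1 (by simp at hj; omega)]; ring
  have h00 : d 0 = 0 := by simpa [hF] using h0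
  intro j hj
  rw [(hd j).1 hj, h00, zero_mul]

open Complex in
def phi : R3 →ₐ[ℝ] MvPolynomial (Fin 3) ℂ :=
  aeval ![C 2⁻¹ * (X 0 + X 1), C (-I/2) * (X 0 - X 1), X 2]

def psi : MvPolynomial (Fin 3) ℂ →ₐ[ℂ] MvPolynomial (Fin 3) ℂ :=
  aeval ![X 0 + C Complex.I * X 1, X 0 - C Complex.I * X 1, X 2]

lemma CI_sq : (C Complex.I : MvPolynomial (Fin 3) ℂ) * C Complex.I = -1 := by
  rw [← C_mul, Complex.I_mul_I]; simp

lemma C_half : (C 2⁻¹ : MvPolynomial (Fin 3) ℂ) * 2 = 1 := by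
  rw [show (2 : MvPolynomial (Fin 3) ℂ) = C 2 from (map_ofNat C 2).symm, ← C_mul]; norm_num

lemma C_nI : (C (-Complex.I/2) : MvPolynomial (Fin 3) ℂ) = - (C Complex.I * C 2⁻¹) := by
  rw [← C_mul, ← C_neg]; congr 1; ring

lemma phi0 : phi (X 0) = C 2⁻¹ * (X 0 + X 1) := by simp [phi]
lemma phi1 : phi (X 1) = - (C Complex.I * C 2⁻¹) * (X 0 - X 1) := by rw [← C_nI]; simp [phi]
lemma phi2 : phi (X 2) = X 2 := by simp [phi]
lemma psi0 : psi (X 0) = X 0 + C Complex.I * X 1 := by simp [psi]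
lemma psi1 : psi (X 1) = X 0 - C Complex.I * X 1 := by simp [psi]
lemma psi2 : psi (X 2) = X 2 := by simp [psi]
lemma psiC (r : ℂ) : psi (C r) = C r := by
  simp [psi]
lemma phiC (r : ℝ) : phi (C r) = C (r : ℂ) := by
  simp [phi]

lemma psi_phi (p : R3) : psi (phi p) = map (algebraMap ℝ ℂ) p := by
  induction p using MvPolynomial.induction_on with
  | C a => rw [phiC, psiC]; simp
  | add p q hp hq => simp [hp, hq]
  | mul_X p i h =>
    rw [map_mul phi, map_mul psi, map_mul (map (algebraMap ℝ ℂ)), h, map_X]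
    refine congrArg (fun z => map (algebraMap ℝ ℂ) p * z) ?_
    fin_cases i
    · change psi (phi (X 0)) = X 0
      rw [phi0]; simp only [map_mul, map_add, psi0, psi1, psiC]
      linear_combination X 0 * C_half
    · change psi (phi (X 1)) = X 1
      rw [phi1]; simp only [map_mul, map_neg, map_sub, psi0, psi1, psiC]
      linear_combination X 1 * C_half - 2 * C 2⁻¹ * X 1 * CI_sq
    · change psi (phi (X 2)) = X 2
      rw [phi2, psi2]

lemma phi_inj (p : R3) (h : phi p = 0) : p = 0 := by
  have := psi_phi p
  rw [h, map_zero] at this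
  apply map_injective (algebraMap ℝ ℂ) (algebraMap ℝ ℂ).injective
  rw [← this, map_zero]

lemma phi_dt (p : R3) : phi (pderiv 2 p) = pderiv 2 (phi p) := by
  induction p using MvPolynomial.induction_on with
  | C a => rw [phiC]; simp
  | add p q hp hq => simp [hp, hq]
  | mul_X p i h =>
    rw [map_mul phi, pderiv_mul, pderiv_mul, map_add, map_mul phi, map_mul phi, h]
    congr 2
    fin_cases i
    · change phi (pderiv 2 (X 0)) = pderiv 2 (phi (X 0))
      rw [phi0]; simp [pderiv_X]
    · change phi (pderiv 2 (X 1)) = pderiv 2 (phi (X 1))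
      rw [phi1]; simp [pderiv_X]
    · change phi (pderiv 2 (X 2)) = pderiv 2 (phi (X 2))
      rw [phi2]; simp [pderiv_X]

lemma phi_dx (p : R3) : phi (pderiv 0 p) = pderiv 0 (phi p) + pderiv 1 (phi p) := by
  induction p using MvPolynomial.induction_on with
  | C a => rw [phiC]; simp
  | add p q hp hq => simp only [map_add, hp, hq]; ring
  | mul_X p i h =>
    have : phi (pderiv 0 (X i)) = pderiv 0 (phi (X i)) + pderiv 1 (phi (X i)) := by
      fin_cases i
      · change phi (pderiv 0 (X 0)) = pderiv 0 (phi (X 0)) + pderiv 1 (phi (X 0))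
        rw [phi0]; simp [pderiv_mul, pderiv_X]
        linear_combination -C_half
      · change phi (pderiv 0 (X 1)) = pderiv 0 (phi (X 1)) + pderiv 1 (phi (X 1))
        rw [phi1]; simp [pderiv_mul, pderiv_X]
      · change phi (pderiv 0 (X 2)) = pderiv 0 (phi (X 2)) + pderiv 1 (phi (X 2))
        rw [phi2]; simp [pderiv_X]
    rw [map_mul phi, pderiv_mul, pderiv_mul, pderiv_mul, map_add, map_mul phi, map_mul phi, h, this]
    ring

lemma phi_dy (p : R3) : phi (pderiv 1 p) = C Complex.I * (pderiv 0 (phi p) - pderiv 1 (phi p)) := by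
  induction p using MvPolynomial.induction_on with
  | C a => rw [phiC]; simp
  | add p q hp hq => simp only [map_add, hp, hq]; ring
  | mul_X p i h =>
    have : phi (pderiv 1 (X i)) = C Complex.I * (pderiv 0 (phi (X i)) - pderiv 1 (phi (X i))) := by
      fin_cases i
      · change phi (pderiv 1 (X 0)) = C Complex.I * (pderiv 0 (phi (X 0)) - pderiv 1 (phi (X 0)))
        rw [phi0]; simp [pderiv_mul, pderiv_X]
      · change phi (pderiv 1 (X 1)) = C Complex.I * (pderiv 0 (phi (X 1)) - pderiv 1 (phi (X 1)))
        rw [phi1]; simp [pderiv_mul, pderiv_X]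
        linear_combination -C_half + 2 * C 2⁻¹ * CI_sq
      · change phi (pderiv 1 (X 2)) = C Complex.I * (pderiv 0 (phi (X 2)) - pderiv 1 (phi (X 2)))
        rw [phi2]; simp [pderiv_X]
    rw [map_mul phi, pderiv_mul, pderiv_mul, pderiv_mul, map_add, map_mul phi, map_mul phi, h, this]
    ring

lemma pd_comm (i j : Fin 3) (P : MvPolynomial (Fin 3) ℂ) :
    pderiv i (pderiv j P) = pderiv j (pderiv i P) := by
  ext m
  rw [coeff_pderiv, coeff_pderiv, coeff_pderiv, coeff_pderiv, add_right_comm]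
  rcases eq_or_ne i j with rfl | h
  · rfl
  · simp [h, h.symm]; ring

lemma phi_X (p : R3) : phi (Xop p) = pderiv 0 (phi p) + pderiv 1 (phi p)
    - C Complex.I * (X 0 - X 1) * pderiv 2 (phi p) := by
  have h2 : phi 2 = 2 := map_ofNat phi 2
  simp only [Xop, LinearMap.add_apply, LinearMap.comp_apply, LinearMap.mulLeft_apply, map_add,
    map_mul, Derivation.coeFn_coe, phi_dx, phi_dt, phi1, h2]
  linear_combination (- C Complex.I * (X 0 - X 1) * pderiv 2 (phi p)) * C_half

lemma phi_Y (p : R3) : phi (Yop p) = C Complex.I * (pderiv 0 (phi p) - pderiv 1 (phi p))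
    - (X 0 + X 1) * pderiv 2 (phi p) := by
  have h2 : phi 2 = 2 := map_ofNat phi 2
  simp only [Yop, LinearMap.sub_apply, LinearMap.comp_apply, LinearMap.mulLeft_apply, map_sub,
    map_mul, Derivation.coeFn_coe, phi_dy, phi_dt, phi0, h2]
  linear_combination (- (X 0 + X 1) * pderiv 2 (phi p)) * C_half

lemma phi_Delta (p : R3) : phi (ΔH p) = 4 * (pderiv 0 (pderiv 1 (phi p))
    + X 0 * (X 1 * pderiv 2 (pderiv 2 (phi p)))
    - C Complex.I * (X 0 * pderiv 0 (pderiv 2 (phi p)) - X 1 * pderiv 1 (pderiv 2 (phi p)))) := by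
  simp only [ΔH, LinearMap.add_apply, LinearMap.comp_apply, map_add, phi_X, phi_Y]
  set P := phi p
  simp only [map_add, map_sub, pderiv_mul, pderiv_C, pderiv_X_self]
  have h01 : pderiv (0 : Fin 3) (X 1 : MvPolynomial (Fin 3) ℂ) = 0 := by simp [pderiv_X]
  have h10 : pderiv (1 : Fin 3) (X 0 : MvPolynomial (Fin 3) ℂ) = 0 := by simp [pderiv_X]
  have h20 : pderiv (2 : Fin 3) (X 0 : MvPolynomial (Fin 3) ℂ) = 0 := by simp [pderiv_X]
  have h21 : pderiv (2 : Fin 3) (X 1 : MvPolynomial (Fin 3) ℂ) = 0 := by simp [pderiv_X]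
  rw [h01, h10, h20, h21, pd_comm 1 0 P, pd_comm 2 0 P, pd_comm 2 1 P]
  linear_combination (exp := 1) ((pderiv 0 (pderiv 0 P) - 2 * pderiv 0 (pderiv 1 P) + pderiv 1 (pderiv 1 P)) + (X 0 - X 1)^2 * pderiv 2 (pderiv 2 P)) * CI_sq

def mk3 (a b l : ℕ) : Fin 3 →₀ ℕ :=
  Finsupp.single 0 a + Finsupp.single 1 b + Finsupp.single 2 l

lemma mk3_eq (m : Fin 3 →₀ ℕ) : m = mk3 (m 0) (m 1) (m 2) := by
  ext i; fin_cases i <;> simp [mk3]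

def cf (P : MvPolynomial (Fin 3) ℂ) (a b l : ℕ) : ℂ := coeff (mk3 a b l) P

lemma mk_s0 (a b l : ℕ) : mk3 a b l + Finsupp.single 0 1 = mk3 (a+1) b l := by
  ext i; fin_cases i <;> simp [mk3]
lemma mk_s1 (a b l : ℕ) : mk3 a b l + Finsupp.single 1 1 = mk3 a (b+1) l := by
  ext i; fin_cases i <;> simp [mk3]
lemma mk_s2 (a b l : ℕ) : mk3 a b l + Finsupp.single 2 1 = mk3 a b (l+1) := by
  ext i; fin_cases i <;> simp [mk3]

section coeffs
variable (P : MvPolynomial (Fin 3) ℂ) (a b l : ℕ)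
lemma cf_d0 : cf (pderiv 0 P) a b l = (a+1) * cf P (a+1) b l := by
  rw [cf, coeff_pderiv, mk_s0, mul_comm]; simp [cf, mk3]
lemma cf_d1 : cf (pderiv 1 P) a b l = (b+1) * cf P a (b+1) l := by
  rw [cf, coeff_pderiv, mk_s1, mul_comm]; simp [cf, mk3]
lemma cf_d2 : cf (pderiv 2 P) a b l = (l+1) * cf P a b (l+1) := by
  rw [cf, coeff_pderiv, mk_s2, mul_comm]; simp [cf, mk3]
lemma cf_x0 : cf (X 0 * P) (a+1) b l = cf P a b l := by
  rw [cf, ← mk_s0, add_comm, coeff_X_mul]; rfl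
lemma cf_x1 : cf (X 1 * P) a (b+1) l = cf P a b l := by
  rw [cf, ← mk_s1, add_comm, coeff_X_mul]; rfl
lemma cf_x2 : cf (X 2 * P) a b (l+1) = cf P a b l := by
  rw [cf, ← mk_s2, add_comm, coeff_X_mul]; rfl
lemma cf_x0z : cf (X 0 * P) 0 b l = 0 := by
  rw [cf, coeff_X_mul', if_neg]; simp [mk3]
lemma cf_x1z : cf (X 1 * P) a 0 l = 0 := by
  rw [cf, coeff_X_mul', if_neg]; simp [mk3]
lemma cf_x2z : cf (X 2 * P) a b 0 = 0 := by
  rw [cf, coeff_X_mul', if_neg]; simp [mk3]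
lemma cf_X0d0 : cf (X 0 * pderiv 0 P) a b l = a * cf P a b l := by
  cases a with
  | zero => simp [cf_x0z]
  | succ a => rw [cf_x0, cf_d0]; push_cast; ring
lemma cf_X1d1 : cf (X 1 * pderiv 1 P) a b l = b * cf P a b l := by
  cases b with
  | zero => simp [cf_x1z]
  | succ a => rw [cf_x1, cf_d1]; push_cast; ring

def DD : MvPolynomial (Fin 3) ℂ := (pderiv 0 (pderiv 1 P)
    + X 0 * (X 1 * pderiv 2 (pderiv 2 P))
    - C Complex.I * (X 0 * pderiv 0 (pderiv 2 P) - X 1 * pderiv 1 (pderiv 2 P)))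

lemma cf_DD : cf (DD P) a b l = (a+1)*(b+1) * cf P (a+1) (b+1) l
    + cf (X 0 * (X 1 * pderiv 2 (pderiv 2 P))) a b l
    - Complex.I * (a - b) * (l+1) * cf P a b (l+1) := by
  have : cf (DD P) a b l = cf (pderiv 0 (pderiv 1 P)) a b l
    + cf (X 0 * (X 1 * pderiv 2 (pderiv 2 P))) a b l
    - Complex.I * (cf (X 0 * pderiv 0 (pderiv 2 P)) a b l - cf (X 1 * pderiv 1 (pderiv 2 P)) a b l) := by
    simp [DD, cf, coeff_C_mul]
  rw [this, cf_X0d0, cf_X1d1, cf_d0, cf_d1, cf_d2]; ring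

lemma cf_mid : cf (X 0 * (X 1 * pderiv 2 (pderiv 2 P))) (a+1) (b+1) l
    = (l+2)*(l+1) * cf P a b (l+2) := by
  rw [cf_x0, cf_x1, cf_d2, cf_d2]; push_cast; ring

end coeffs

lemma sum_tel (e : ℕ → ℂ) (n : ℕ) :
    ∀ d : ℕ → ℂ, d 0 = 4 * e 0 → (∀ j, j + 1 ≤ n → d (j+1) = e j + 4 * e (j+1)) →
    ∑ j ∈ Finset.range (n+1), d j * (-4)^j = 4 * e n * (-4)^n := by
  intro d h0 h
  induction n with
  | zero => simp [h0]
  | succ n ih =>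
    rw [Finset.sum_range_succ, ih (fun j hj => h j (by omega)), h n le_rfl]; ring

lemma main_zero (Q : MvPolynomial (Fin 3) ℂ) (h : DD ((X 0 * X 1 + 4 * X 2) * Q) = 0) :
    (X 0 * X 1 + 4 * X 2) * Q = 0 := by
  set P := (X 0 * X 1 + 4 * X 2) * Q with hP
  have hcf : ∀ a b l, cf P a b l = cf (X 0 * (X 1 * Q)) a b l + 4 * cf (X 2 * Q) a b l := by
    intro a b l
    have : P = X 0 * (X 1 * Q) + C 4 * (X 2 * Q) := by
      rw [hP, show (C 4 : MvPolynomial (Fin 3) ℂ) = 4 from map_ofNat C 4]; ring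
    rw [this]; simp only [cf, coeff_add, coeff_C_mul]
  have hD : ∀ a b l, cf (DD P) a b l = 0 := by intro a b l; rw [h]; simp [cf]
  have A1 : ∀ k n, ∀ j ≤ n, cf P (k+j) j (n-j) = 0 := by
    intro k n
    apply seq_zero k n 1 one_ne_zero (fun j => cf P (k+j) j (n-j))
    · rintro l rfl
      have := hD k 0 l
      rw [cf_DD, ← mul_left_comm (X 1), cf_x1z] at this
      simp at this ⊢
      linear_combination this
    · rintro j l rfl
      have := hD (k+j+1) (j+1) l
      rw [cf_DD, cf_mid] at this
      simp only [show j + 2 + l - (j+2) = l by omega, show j + 2 + l - (j+1) = l+1 by omega,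
        show j + 2 + l - j = l+2 by omega]
      push_cast at this ⊢
      linear_combination this
    · rw [sum_tel (fun j => cf (X 2 * Q) (k+j) j (n-j)) n]
      · simp [cf_x2z]
      · simp only [hcf]; rw [← mul_left_comm (X 1), cf_x1z]; simp
      · intro j hj
        simp only [hcf]
        obtain ⟨l, rfl⟩ := Nat.exists_eq_add_of_le hj
        rw [show k + (j+1) = k + j + 1 by ring, cf_x0, cf_x1, show j + 1 + l - j = l + 1 by omega,
          cf_x2, show j + 1 + l - (j+1) = l by omega]
  have A2 : ∀ k n, ∀ j ≤ n, cf P j (k+j) (n-j) = 0 := by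
    intro k n
    apply seq_zero k n (-1) (by norm_num) (fun j => cf P j (k+j) (n-j))
    · rintro l rfl
      have := hD 0 k l
      rw [cf_DD, cf_x0z] at this
      simp at this ⊢
      linear_combination this
    · rintro j l rfl
      have := hD (j+1) (k+j+1) l
      rw [cf_DD, cf_mid] at this
      simp only [show j + 2 + l - (j+2) = l by omega, show j + 2 + l - (j+1) = l+1 by omega,
        show j + 2 + l - j = l+2 by omega]
      push_cast at this ⊢
      linear_combination this
    · rw [sum_tel (fun j => cf (X 2 * Q) j (k+j) (n-j)) n]
      · simp [cf_x2z]
      · simp only [hcf]; rw [cf_x0z]; simp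
      · intro j hj
        simp only [hcf]
        obtain ⟨l, rfl⟩ := Nat.exists_eq_add_of_le hj
        rw [show k + (j+1) = k + j + 1 by ring, cf_x0, cf_x1, show j + 1 + l - j = l + 1 by omega,
          cf_x2, show j + 1 + l - (j+1) = l by omega]
  ext m
  rw [mk3_eq m, coeff_zero]
  change cf P _ _ _ = 0
  rcases le_total (m 1) (m 0) with hle | hle
  · have := A1 (m 0 - m 1) (m 1 + m 2) (m 1) (by omega)
    rwa [show m 0 - m 1 + m 1 = m 0 by omega, show m 1 + m 2 - m 1 = m 2 by omega] at this
  · have := A2 (m 1 - m 0) (m 0 + m 2) (m 0) (by omega)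
    rwa [show m 1 - m 0 + m 0 = m 1 by omega, show m 0 + m 2 - m 0 = m 2 by omega] at this

lemma phi_eta : phi etaSq = X 0 * X 1 + 4 * X 2 := by
  have h4 : phi 4 = 4 := map_ofNat phi 4
  simp only [etaSq, map_add, map_mul, map_pow, phi0, phi1, phi2, h4]
  linear_combination (C 2⁻¹ * C 2⁻¹ * (X 0 - X 1)^2) * CI_sq + X 0 * X 1 * (2 * C 2⁻¹ + 1) * C_half

lemma T_inj (q : R3) (h : ΔH (etaSq * q) = 0) : q = 0 := by
  have h1 := phi_Delta (etaSq * q)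
  rw [h, map_zero, map_mul, phi_eta] at h1
  have h2 : DD ((X 0 * X 1 + 4 * X 2) * phi q) = 0 := by
    rcases mul_eq_zero.mp h1.symm with h3 | h3
    · exfalso
      rw [show (4 : MvPolynomial (Fin 3) ℂ) = C 4 from (map_ofNat C 4).symm] at h3
      simp at h3
    · exact h3
  have h3 := main_zero _ h2
  rw [← phi_eta, ← map_mul] at h3
  have h4 := phi_inj _ h3
  rcases mul_eq_zero.mp h4 with h5 | h5
  · exfalso
    have := congrArg (eval ![1, 0, 0]) h5
    simp [etaSq] at this
  · exact h5

lemma Pm_Xop {m : ℤ} {p : R3} (hp : p ∈ Pm m) : Xop p ∈ Pm (m - 1) := by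
  have hp' : IsWeightedHomogeneous w3 p m := hp
  refine Submodule.add_mem _ ?_ ?_
  · exact hp'.pderiv (by simp [w3])
  · have h1 : IsWeightedHomogeneous w3 (pderiv 2 p) (m - 2) := hp'.pderiv (by simp [w3])
    have h2 : IsWeightedHomogeneous w3 (C 2 * X 1 : R3) 1 :=
      (isWeightedHomogeneous_X ℝ w3 1).C_mul 2
    have h3 := h2.mul h1
    rw [show (1 : ℤ) + (m - 2) = m - 1 by ring] at h3
    exact h3

lemma Pm_Yop {m : ℤ} {p : R3} (hp : p ∈ Pm m) : Yop p ∈ Pm (m - 1) := by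
  have hp' : IsWeightedHomogeneous w3 p m := hp
  refine Submodule.sub_mem _ ?_ ?_
  · exact hp'.pderiv (by simp [w3])
  · have h1 : IsWeightedHomogeneous w3 (pderiv 2 p) (m - 2) := hp'.pderiv (by simp [w3])
    have h2 : IsWeightedHomogeneous w3 (C 2 * X 0 : R3) 1 :=
      (isWeightedHomogeneous_X ℝ w3 0).C_mul 2
    have h3 := h2.mul h1
    rw [show (1 : ℤ) + (m - 2) = m - 1 by ring] at h3
    exact h3

lemma Pm_Delta {m : ℤ} {p : R3} (hp : p ∈ Pm m) : ΔH p ∈ Pm (m - 2) := by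
  have h1 := Pm_Xop (Pm_Xop hp)
  have h2 := Pm_Yop (Pm_Yop hp)
  rw [show m - 1 - 1 = m - 2 by ring] at h1 h2
  exact Submodule.add_mem _ h1 h2

lemma Pm_eta {m : ℤ} {q : R3} (hq : q ∈ Pm (m - 2)) : etaSq * q ∈ Pm m := by
  have hq' : IsWeightedHomogeneous w3 q (m-2) := hq
  have h : IsWeightedHomogeneous w3 etaSq 2 := by
    refine ((?_ : IsWeightedHomogeneous w3 (X 0 ^ 2 : R3) 2).add ?_).add ?_
    · exact (isWeightedHomogeneous_X ℝ w3 0).pow 2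
    · exact (isWeightedHomogeneous_X ℝ w3 1).pow 2
    · exact (isWeightedHomogeneous_X ℝ w3 2).C_mul 4
  have := h.mul hq'
  rw [show (2 : ℤ) + (m - 2) = m by ring] at this
  exact this

lemma Pm_fin (m : ℤ) : Module.Finite ℝ (Pm m) := by
  have hle : Pm m ≤ restrictTotalDegree (Fin 3) ℝ m.toNat := by
    intro p hp
    have hp' : IsWeightedHomogeneous w3 p m := hp
    rw [mem_restrictTotalDegree, totalDegree, Finset.sup_le_iff]
    intro d hd
    have := hp' (mem_support_iff.mp hd)
    rw [Finsupp.weight_apply, Finsupp.sum_fintype _ _ (by simp)] at this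
    rw [Finsupp.sum_fintype _ _ (by simp)]
    simp [Fin.sum_univ_three, w3] at this ⊢
    omega
  exact Submodule.finiteDimensional_of_le hle

/-- `P_m = H_m ⊕ η₊² P_{m−2}`: every `p ∈ P_m` decomposes as
`p = h + η₊² q` with `h ∈ H_m`, `q ∈ P_{m−2}`, and the decomposition is unique. -/
theorem stmt0 (m : ℕ) :
    (∀ p ∈ Pm (m : ℤ), ∃ h ∈ Hm (m : ℤ), ∃ q ∈ Pm ((m : ℤ) - 2),
        p = h + etaSq * q) ∧
    (∀ h ∈ Hm (m : ℤ), ∀ q ∈ Pm ((m : ℤ) - 2), ∀ h' ∈ Hm (m : ℤ), ∀ q' ∈ Pm ((m : ℤ) - 2),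
        h + etaSq * q = h' + etaSq * q' → h = h' ∧ q = q') := by
  constructor
  · intro p hp
    have := Pm_fin ((m:ℤ) - 2)
    let T : Pm ((m:ℤ)-2) →ₗ[ℝ] Pm ((m:ℤ)-2) :=
      LinearMap.restrict (ΔH ∘ₗ LinearMap.mulLeft ℝ etaSq) (fun q hq => Pm_Delta (Pm_eta hq))
    have hT : Function.Injective T := by
      rw [← LinearMap.ker_eq_bot, LinearMap.ker_eq_bot']
      intro q hq
      have : ΔH (etaSq * (q : R3)) = 0 := congrArg Subtype.val hq
      exact Subtype.ext (T_inj _ this)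
    obtain ⟨q, hq⟩ := LinearMap.surjective_of_injective hT ⟨ΔH p, Pm_Delta hp⟩
    have hq' : ΔH (etaSq * (q : R3)) = ΔH p := congrArg Subtype.val hq
    refine ⟨p - etaSq * q, ⟨Submodule.sub_mem _ hp (Pm_eta q.2), ?_⟩, q, q.2, by ring⟩
    rw [SetLike.mem_coe, LinearMap.mem_ker, map_sub, hq', sub_self]
  · intro h hh q hq h' hh' q' hq' e
    have e1 : etaSq * (q - q') = h' - h := by linear_combination e
    have h0 : q - q' = 0 := by
      apply T_inj
      have a := hh.2
      have b := hh'.2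
      rw [SetLike.mem_coe, LinearMap.mem_ker] at a b
      rw [e1, map_sub, a, b, sub_zero]
    have h1 : q = q' := sub_eq_zero.mp h0
    subst h1
    exact ⟨by linear_combination e, rfl⟩

end
end

section
/- Let m ∈ ℕ and K = ⌊m/2⌋. Every polynomial p ∈ P_m admits a unique representation p = Σ_{j=0}^{K} (η₊²)^j · h_j, where h_j ∈ H_{m−2j} for each j = 0, …, K; uniqueness means that if Σ_{j=0}^{K} (η₊²)^j · h_j = Σ_{j=0}^{K} (η₊²)^j · h'_j with h_j, h'_j ∈ H_{m−2j} for all j, then h_j = h'_j for all j. -/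
open MvPolynomial

noncomputable section

namespace HeisAux

/-- auxiliary sequence -/
def al (n : ℕ) : ℕ → ℂ
  | 0 => 1
  | 1 => Complex.I * n / (n + 1)
  | (j + 2) => (Complex.I * n * al n (j + 1) - (j + 1) * al n j) / (n + j + 2)

lemma al_one (n : ℕ) : ((n : ℂ) + 1) * al n 1 = Complex.I * n := by
  have : (n : ℂ) + 1 ≠ 0 := by exact_mod_cast Nat.succ_ne_zero n
  simp only [al]; field_simp

lemma al_two (n j : ℕ) : ((n : ℂ) + j + 2) * al n (j + 2) =
    Complex.I * n * al n (j + 1) - (j + 1) * al n j := by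
  have : (n : ℂ) + j + 2 ≠ 0 := by exact_mod_cast Nat.succ_ne_zero (n + j + 1)
  simp only [al]; field_simp

/-- umbral functional -/
def Lam (n : ℕ) : Polynomial ℂ →ₗ[ℂ] ℂ := (Polynomial.basisMonomials ℂ).constr ℂ (al n)

lemma Lam_monomial (n j : ℕ) : Lam n (Polynomial.X ^ j) = al n j := by
  have := (Polynomial.basisMonomials ℂ).constr_basis ℂ (al n) j
  rw [Polynomial.coe_basisMonomials] at this
  simp only [Polynomial.monomial_one_right_eq_X_pow] at this
  exact this

lemma Lam_C_mul (n : ℕ) (c : ℂ) (p : Polynomial ℂ) :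
    Lam n (Polynomial.C c * p) = c * Lam n p := by
  rw [← Polynomial.smul_eq_C_mul, map_smul, smul_eq_mul]

lemma Lam_rel (n : ℕ) (p : Polynomial ℂ) :
    Lam n ((Polynomial.C ((n : ℂ) + 1) * Polynomial.X - Polynomial.C (Complex.I * n)) * p + (Polynomial.X ^ 2 + 1) * Polynomial.derivative p) = 0 := by
  induction p using Polynomial.induction_on' with
  | add p q hp hq =>
    rw [← add_zero (0 : ℂ)]
    nth_rewrite 1 [← hp]
    rw [← hq, ← map_add]
    congr 1
    rw [Polynomial.derivative_add]; ring
  | monomial j c =>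
    rw [← Polynomial.C_mul_X_pow_eq_monomial]
    rcases j with _ | j
    · have : (Polynomial.C ((n : ℂ) + 1) * Polynomial.X - Polynomial.C (Complex.I * n)) * (Polynomial.C c * Polynomial.X ^ 0) +
          (Polynomial.X ^ 2 + 1) * Polynomial.derivative (Polynomial.C c * Polynomial.X ^ 0) =
          Polynomial.C (c * (n + 1)) * Polynomial.X ^ 1 - Polynomial.C (c * (Complex.I * n)) * Polynomial.X ^ 0 := by
        simp; ring
      rw [this, map_sub, Lam_C_mul, Lam_C_mul, Lam_monomial, Lam_monomial]
      have := al_one n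
      simp only [al, mul_one] at *
      linear_combination c * this
    · have : (Polynomial.C ((n : ℂ) + 1) * Polynomial.X - Polynomial.C (Complex.I * n)) * (Polynomial.C c * Polynomial.X ^ (j + 1)) +
          (Polynomial.X ^ 2 + 1) * Polynomial.derivative (Polynomial.C c * Polynomial.X ^ (j + 1)) =
          Polynomial.C (c * (n + j + 2)) * Polynomial.X ^ (j + 2) - Polynomial.C (c * (Complex.I * n)) * Polynomial.X ^ (j + 1)
            + Polynomial.C (c * (j + 1)) * Polynomial.X ^ j := by
        rw [Polynomial.derivative_C_mul, Polynomial.derivative_X_pow]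
        simp only [Polynomial.C_mul, Polynomial.C_add, Nat.cast_add, Nat.cast_one, Nat.add_sub_cancel, map_one, map_ofNat]
        ring
      rw [this, map_add, map_sub, Lam_C_mul, Lam_C_mul, Lam_C_mul, Lam_monomial, Lam_monomial,
        Lam_monomial]
      linear_combination c * al_two n j

/-- the values -/
def S (n k : ℕ) : ℂ := ∑ j ∈ Finset.range (k + 1), (k.choose j : ℂ) * al n j * (-4) ^ j

lemma S_eq (n k : ℕ) : S n k = Lam n ((1 - Polynomial.C 4 * Polynomial.X) ^ k) := by
  have : (1 - Polynomial.C (4 : ℂ) * Polynomial.X) ^ k = ((Polynomial.C (-4) * Polynomial.X) + 1) ^ k := by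
    congr 1; rw [Polynomial.C_neg]; ring
  rw [this, add_pow, map_sum, S]
  refine Finset.sum_congr rfl fun j _ => ?_
  have : (Polynomial.C (-4 : ℂ) * Polynomial.X) ^ j * 1 ^ (k - j) * (k.choose j : Polynomial ℂ) =
      Polynomial.C ((k.choose j : ℂ) * (-4) ^ j) * Polynomial.X ^ j := by
    rw [mul_pow, Polynomial.C_mul, Polynomial.C_pow, one_pow, ← Polynomial.C_eq_natCast]; ring
  rw [this, Lam_C_mul, Lam_monomial]; ring

lemma S_zero (n : ℕ) : S n 0 = 1 := by simp [S, al]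

lemma S_one (n : ℕ) : ((n : ℂ) + 1) * S n 1 = n + 1 - 4 * Complex.I * n := by
  have := al_one n
  simp [S, al, Finset.sum_range_succ] at *
  linear_combination (-4) * this

lemma S_rec (n k : ℕ) : ((n : ℂ) + k + 2) * S n (k + 2) =
    (n + 2 * k + 3 - 4 * Complex.I * n) * S n (k + 1) - 17 * (k + 1) * S n k := by
  have h := Lam_rel n ((1 - Polynomial.C 4 * Polynomial.X) ^ (k + 1))
  have e : (Polynomial.C ((n : ℂ) + 1) * Polynomial.X - Polynomial.C (Complex.I * n)) * (1 - Polynomial.C 4 * Polynomial.X) ^ (k + 1) +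
      (Polynomial.X ^ 2 + 1) * Polynomial.derivative ((1 - Polynomial.C 4 * Polynomial.X) ^ (k + 1)) =
      Polynomial.C (1/4 : ℂ) * (Polynomial.C ((n : ℂ) + 2 * k + 3 - 4 * Complex.I * n) * (1 - Polynomial.C 4 * Polynomial.X) ^ (k + 1)
        - Polynomial.C (17 * ((k : ℂ) + 1)) * (1 - Polynomial.C 4 * Polynomial.X) ^ k - Polynomial.C ((n : ℂ) + k + 2) * (1 - Polynomial.C 4 * Polynomial.X) ^ (k + 2)) := by
    rw [Polynomial.derivative_pow]
    have h4 : (4 : Polynomial ℂ) * Polynomial.C (1/4 : ℂ) = 1 := by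
      rw [← map_ofNat Polynomial.C 4, ← Polynomial.C_mul]; norm_num
    generalize Polynomial.C (1/4 : ℂ) = q at *
    simp only [map_sub, map_add, map_mul, map_one, map_ofNat, map_natCast, Nat.add_sub_cancel,
      Nat.cast_add, Nat.cast_one, Polynomial.derivative_mul, Polynomial.derivative_one,
      Polynomial.derivative_X, Polynomial.derivative_ofNat]
    linear_combination (-(((n : Polynomial ℂ) + 1) * Polynomial.X - Polynomial.C Complex.I * n) *
      (1 - 4 * Polynomial.X) ^ (k + 1) + (Polynomial.X ^ 2 + 1) * 4 * (k + 1) *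
      (1 - 4 * Polynomial.X) ^ k) * h4
  rw [e, Lam_C_mul, map_sub, map_sub, Lam_C_mul, Lam_C_mul, Lam_C_mul, ← S_eq, ← S_eq, ← S_eq] at h
  linear_combination (-4) * h

lemma S_im (n : ℕ) (hn : 0 < n) (k : ℕ) : (S n (k + 1) * (starRingEnd ℂ) (S n k)).im < 0 := by
  have hn' : (0 : ℝ) < n := by exact_mod_cast hn
  induction k with
  | zero =>
    have h := congrArg Complex.im (S_one n)
    simp [S_zero] at h ⊢
    nlinarith
  | succ k ih =>
    have h := S_rec n k
    have h1 := congrArg Complex.im h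
    have h2 := congrArg Complex.re h
    simp at h1 h2 ih ⊢
    have hne : 0 < (S n (k+1)).re ^ 2 + (S n (k+1)).im ^ 2 := by
      by_contra hc
      have h3 : (S n (k+1)).re = 0 := by nlinarith [sq_nonneg (S n (k+1)).re, sq_nonneg (S n (k+1)).im]
      have h4 : (S n (k+1)).im = 0 := by nlinarith [sq_nonneg (S n (k+1)).re, sq_nonneg (S n (k+1)).im]
      simp [h3, h4] at ih
    rw [show k + 1 + 1 = k + 2 from rfl]
    generalize (S n (k+2)).re = a, (S n (k+2)).im = b, (S n (k+1)).re = c,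
      (S n (k+1)).im = d, (S n k).re = e, (S n k).im = f at *
    have hk : (0 : ℝ) ≤ k := Nat.cast_nonneg k
    have hpos : (0 : ℝ) < n + k + 2 := by positivity
    have e1 : ((n : ℝ) + k + 2) * (-(a * d) + b * c) =
        -4 * n * (c ^ 2 + d ^ 2) + 17 * (k + 1) * (-(c * f) + d * e) := by
      linear_combination c * h1 - d * h2
    have e2 : ((n : ℝ) + k + 2) * (-(a * d) + b * c) < 0 := by
      rw [e1]
      have p1 := mul_pos hn' hne
      have p2 : 17 * ((k : ℝ) + 1) * (-(c * f) + d * e) < 0 :=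
        mul_neg_of_pos_of_neg (by positivity) (by linarith)
      linarith
    have e3 := (pos_iff_neg_of_mul_neg e2).mp hpos
    linarith

lemma al_zero_odd (i : ℕ) : al 0 (2 * i + 1) = 0 := by
  induction i with
  | zero => simp [al]
  | succ i ih =>
    have := al_two 0 (2 * i + 1)
    rw [ih] at this
    have h0 : ((2 * i + 1 : ℕ) : ℂ) + 2 ≠ 0 := by exact_mod_cast Nat.succ_ne_zero (2 * i + 2)
    have h1 : (((2 * i + 1 : ℕ) : ℂ) + 2) * al 0 (2 * i + 1 + 2) = 0 := by
      simpa using this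
    exact (mul_eq_zero.mp h1).resolve_left h0

lemma al_zero_even (i : ℕ) : al 0 (2 * i) * (-4) ^ (2 * i) = (-4) ^ i * (Nat.centralBinom i : ℂ) := by
  induction i with
  | zero => simp [al]
  | succ i ih =>
    have h := al_two 0 (2 * i)
    have hc : ((i + 1) * Nat.centralBinom (i + 1) : ℂ) = 2 * (2 * i + 1) * Nat.centralBinom i := by
      exact_mod_cast Nat.succ_mul_centralBinom_succ i
    have h0 : (i : ℂ) + 1 ≠ 0 := by exact_mod_cast Nat.succ_ne_zero i
    apply mul_left_cancel₀ h0
    rw [show 2 * (i + 1) = 2 * i + 2 by ring]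
    push_cast at h
    rw [pow_add, pow_succ]
    linear_combination 8 * (-4) ^ (2 * i) * h - 8 * (2 * i + 1) * ih - (-4) ^ i * (-4) * hc

lemma S_zero_ne (k : ℕ) : S 0 k ≠ 0 := by
  have key : ∀ j : ℕ, ∃ z : ℤ, al 0 (j + 1) * (-4) ^ (j + 1) = ((4 * z : ℤ) : ℂ) := by
    intro j
    rcases Nat.even_or_odd' (j + 1) with ⟨i, hi | hi⟩
    · rw [hi, al_zero_even]
      obtain ⟨l, rfl⟩ : ∃ l, i = l + 1 := ⟨i - 1, by omega⟩
      refine ⟨-(-4) ^ l * Nat.centralBinom (l + 1), ?_⟩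
      push_cast; ring
    · rw [hi, al_zero_odd]; exact ⟨0, by simp⟩
  choose z hz using key
  have : S 0 k = ((1 + 4 * ∑ j ∈ Finset.range k, (k.choose (j + 1) : ℤ) * z j : ℤ) : ℂ) := by
    rw [S, Finset.sum_range_succ']
    simp only [Nat.choose_zero_right, al, pow_zero]
    push_cast
    rw [Finset.mul_sum, add_comm]
    congr 1
    · simp
    refine Finset.sum_congr rfl fun j _ => ?_
    rw [mul_assoc, hz]; push_cast; ring
  rw [this]
  norm_cast
  omega

lemma S_ne (n k : ℕ) : S n k ≠ 0 := by
  rcases Nat.eq_zero_or_pos n with rfl | hn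
  · exact S_zero_ne k
  · intro h
    have := S_im n hn k
    simp [h] at this

lemma core (n k : ℕ) (a : ℕ → ℂ)
    (h1 : 0 < k → ((n : ℂ) + 1) * a 1 = Complex.I * n * k * a 0)
    (h2 : ∀ j, j + 1 < k → ((j : ℂ) + 2) * (j + 2 + n) * a (j + 2) =
      Complex.I * n * (k - (j + 1)) * a (j + 1) - (k - j) * (k - (j + 1)) * a j)
    (hs : ∑ j ∈ Finset.range (k + 1), a j * (-4) ^ j = 0) : ∀ j ≤ k, a j = 0 := by
  have key : ∀ j, (j ≤ k → a j = a 0 * (k.choose j * al n j)) ∧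
      (j + 1 ≤ k → a (j + 1) = a 0 * (k.choose (j + 1) * al n (j + 1))) := by
    intro j
    induction j with
    | zero =>
      refine ⟨fun _ => by simp [al], fun hk => ?_⟩
      have h0 : (n : ℂ) + 1 ≠ 0 := by exact_mod_cast Nat.succ_ne_zero n
      apply mul_left_cancel₀ h0
      have := al_one n
      simp only [zero_add, Nat.choose_one_right]
      rw [h1 hk]
      linear_combination (-a 0 * k) * this
    | succ j ih =>
      refine ⟨ih.2, fun hk => ?_⟩
      have e1 := ih.1 (by omega)
      have e2 := ih.2 (by omega)
      have h := h2 j (by omega)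
      rw [e1, e2] at h
      have c1 : ((k.choose (j + 1) : ℂ)) * (j + 1) = k.choose j * (k - j) := by
        have := Nat.choose_succ_right_eq k j
        rw [← Nat.cast_sub (by omega : j ≤ k)]
        exact_mod_cast this
      have c2 : ((k.choose (j + 2) : ℂ)) * (j + 2) = k.choose (j + 1) * (k - (j + 1)) := by
        have := Nat.choose_succ_right_eq k (j + 1)
        have e : ((k : ℂ) - (j + 1)) = ((k - (j + 1) : ℕ) : ℂ) := by
          rw [Nat.cast_sub (by omega : j + 1 ≤ k)]; push_cast; ring
        rw [e]
        exact_mod_cast this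
      have h0 : ((j : ℂ) + 2) * (j + 2 + n) ≠ 0 := by
        have h00 : ((j + 2) * (j + 2 + n) : ℕ) ≠ 0 := by positivity
        exact_mod_cast h00
      apply mul_left_cancel₀ h0
      rw [show j + 1 + 1 = j + 2 by ring, h]
      have := al_two n j
      linear_combination (-a 0 * (k.choose (j + 2)) * (j + 2)) * this
        - a 0 * (Complex.I * n * al n (j + 1) - (j + 1) * al n j) * c2
        + a 0 * al n j * (k - (j + 1)) * c1
  have h0 : a 0 = 0 := by
    have : a 0 * S n k = 0 := by
      rw [← hs, S, Finset.mul_sum]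
      refine Finset.sum_congr rfl fun j hj => ?_
      rw [(key j).1 (by simpa [Nat.lt_succ_iff] using hj)]; ring
    exact (mul_eq_zero.mp this).resolve_right (S_ne n k)
  intro j hj
  rw [(key j).1 hj, h0, zero_mul]

end HeisAux
namespace HeisAux

lemma coreT (n : ℕ) (f g : ℕ → ℕ → ℂ)
    (hd0 : ∀ c : ℕ, ((n : ℂ) + 1) * f 1 c = Complex.I * n * (c + 1) * f 0 (c + 1))
    (hd : ∀ j c : ℕ, ((j : ℂ) + 2) * (j + 2 + n) * f (j + 2) c =
      Complex.I * n * (c + 1) * f (j + 1) (c + 1) - (c + 2) * (c + 1) * f j (c + 2))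
    (e00 : f 0 0 = 0) (e01 : ∀ c, f 0 (c + 1) = 4 * g 0 c)
    (e10 : ∀ j, f (j + 1) 0 = g j 0)
    (e11 : ∀ j c, f (j + 1) (c + 1) = g j (c + 1) + 4 * g (j + 1) c) (j c : ℕ) : f j c = 0 := by
  have hk : ∀ k, ∀ j ≤ k, f j (k - j) = 0 := by
    intro k
    apply core n k (fun j => f j (k - j))
    · intro hk
      obtain ⟨c, rfl⟩ : ∃ c, k = c + 1 := ⟨k - 1, by omega⟩
      simpa using hd0 c
    · intro j hj
      obtain ⟨c, rfl⟩ : ∃ c, k = j + 2 + c := ⟨k - (j + 2), by omega⟩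
      have := hd j c
      simp only [show j + 2 + c - (j + 2) = c by omega, show j + 2 + c - (j + 1) = c + 1 by omega,
        show j + 2 + c - j = c + 2 by omega]
      push_cast
      rw [this]; ring
    · rcases k with _ | k
      · simp [e00]
      have hp : ∀ l ≤ k, ∑ j ∈ Finset.range (l + 1), f j (k + 1 - j) * (-4) ^ j =
          4 * g l (k - l) * (-4) ^ l := by
        intro l
        induction l with
        | zero => intro _; simp [e01]
        | succ l ih =>
          intro hl
          rw [Finset.sum_range_succ, ih (by omega)]
          obtain ⟨c, rfl⟩ : ∃ c, k = l + 1 + c := ⟨k - (l + 1), by omega⟩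
          simp only [show l + 1 + c + 1 - (l + 1) = c + 1 by omega,
            show l + 1 + c - (l + 1) = c by omega, show l + 1 + c - l = c + 1 by omega]
          rw [e11]; ring
      rw [Finset.sum_range_succ, hp k le_rfl]
      simp only [Nat.sub_self, e10]; ring
  have := hk (j + c) j (by omega)
  simpa using this

abbrev RC := MvPolynomial (Fin 3) ℂ

def phi : R3 →ₐ[ℝ] RC :=
  aeval ![C (1/2 : ℂ) * (X 0 + X 1), C (-Complex.I / 2) * (X 0 - X 1), X 2]

lemma phi_C (r : ℝ) : phi (C r) = C (r : ℂ) := by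
  rw [phi, aeval_C]; rfl

lemma phi_X0 : phi (X 0) = C (1/2 : ℂ) * (X 0 + X 1) := by simp [phi]
lemma phi_X1 : phi (X 1) = C (-Complex.I / 2 : ℂ) * (X 0 - X 1) := by simp [phi]
lemma phi_X2 : phi (X 2) = X 2 := by simp [phi]

lemma half2 : (2 : RC) * C (1/2 : ℂ) = 1 := by
  rw [← map_ofNat (C : ℂ →+* RC) 2, ← C_mul]; norm_num
lemma I2 : (C Complex.I : RC) * C Complex.I = -1 := by
  rw [← C_mul]; simp
lemma hI : (C (-Complex.I / 2) : RC) = - C Complex.I * C (1/2 : ℂ) := by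
  rw [← C_neg, ← C_mul]; congr 1; ring

lemma n01 : (0 : Fin 3) ≠ 1 := by decide
lemma n02 : (0 : Fin 3) ≠ 2 := by decide
lemma n12 : (1 : Fin 3) ≠ 2 := by decide

lemma phi_d0 (p : R3) : phi (pderiv 0 p) = pderiv 0 (phi p) + pderiv 1 (phi p) := by
  induction p using MvPolynomial.induction_on with
  | C r => rw [phi_C]; simp
  | add p q hp hq => simp only [map_add, hp, hq]; ring
  | mul_X p i hp =>
    have h3 : i = 0 ∨ i = 1 ∨ i = 2 := by fin_cases i <;> simp
    rcases h3 with rfl | rfl | rfl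
    · simp only [pderiv_mul, map_add, map_mul, hp, phi_X0, pderiv_C, pderiv_X_self,
        pderiv_X_of_ne n01, pderiv_X_of_ne n01.symm, map_one]
      linear_combination (-phi p) * half2
    · simp only [pderiv_mul, map_add, map_sub, map_mul, hp, phi_X1, pderiv_C, pderiv_X_self,
        pderiv_X_of_ne n01, pderiv_X_of_ne n01.symm, map_zero]
      ring
    · simp only [pderiv_mul, map_add, map_mul, hp, phi_X2, pderiv_X_of_ne n02.symm,
        pderiv_X_of_ne n12.symm, map_zero]
      ring

lemma phi_d1 (p : R3) : phi (pderiv 1 p) = C Complex.I * (pderiv 0 (phi p) - pderiv 1 (phi p)) := by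
  induction p using MvPolynomial.induction_on with
  | C r => rw [phi_C]; simp
  | add p q hp hq => simp only [map_add, hp, hq]; ring
  | mul_X p i hp =>
    have h3 : i = 0 ∨ i = 1 ∨ i = 2 := by fin_cases i <;> simp
    rcases h3 with rfl | rfl | rfl
    · simp only [pderiv_mul, map_add, map_mul, hp, phi_X0, pderiv_C, pderiv_X_self,
        pderiv_X_of_ne n01, pderiv_X_of_ne n01.symm, map_zero]
      ring
    · simp only [pderiv_mul, map_add, map_sub, map_mul, map_neg, hp, phi_X1, hI, pderiv_C,
        pderiv_X_self, pderiv_X_of_ne n01, pderiv_X_of_ne n01.symm, map_one]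
      linear_combination (-phi p) * half2 + 2 * C (1/2 : ℂ) * phi p * I2
    · simp only [pderiv_mul, map_add, map_mul, hp, phi_X2, pderiv_X_of_ne n02.symm,
        pderiv_X_of_ne n12.symm, map_zero]
      ring

lemma phi_d2 (p : R3) : phi (pderiv 2 p) = pderiv 2 (phi p) := by
  induction p using MvPolynomial.induction_on with
  | C r => simp [phi_C]
  | add p q hp hq => simp only [map_add, hp, hq]
  | mul_X p i hp =>
    fin_cases i
    all_goals
      simp [pderiv_mul, hp, phi_X0, phi_X1, phi_X2, pderiv_X_of_ne]

lemma pd_comm (i j : Fin 3) (p : RC) : pderiv i (pderiv j p) = pderiv j (pderiv i p) := by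
  ext m
  simp only [coeff_pderiv, Finsupp.add_apply]
  rcases eq_or_ne i j with rfl | h
  · rfl
  · rw [Finsupp.single_eq_of_ne h, Finsupp.single_eq_of_ne h.symm, add_right_comm]
    push_cast; ring

def Lap (F : RC) : RC :=
  4 * pderiv 0 (pderiv 1 F) - 4 * C Complex.I * (X 0 * pderiv 0 (pderiv 2 F)
    - X 1 * pderiv 1 (pderiv 2 F)) + 4 * (X 0 * (X 1 * pderiv 2 (pderiv 2 F)))

lemma phi_Xop (p : R3) : phi (Xop p) = pderiv 0 (phi p) + pderiv 1 (phi p)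
    - C Complex.I * ((X 0 - X 1) * pderiv 2 (phi p)) := by
  simp only [Xop, LinearMap.add_apply, LinearMap.comp_apply,
    LinearMap.mulLeft_apply, Derivation.coeFn_coe, map_add, map_mul, phi_d0,
    phi_d2, phi_X1, map_ofNat, hI]
  linear_combination (-C Complex.I * (X 0 - X 1) * pderiv 2 (phi p)) * half2

lemma phi_Yop (p : R3) : phi (Yop p) = C Complex.I * (pderiv 0 (phi p) - pderiv 1 (phi p))
    - (X 0 + X 1) * pderiv 2 (phi p) := by
  simp only [Yop, LinearMap.sub_apply, LinearMap.comp_apply,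
    LinearMap.mulLeft_apply, Derivation.coeFn_coe, map_sub, map_mul, phi_d1,
    phi_d2, phi_X0, map_ofNat]
  linear_combination (-(X 0 + X 1) * pderiv 2 (phi p)) * half2

lemma phi_lap (p : R3) : phi (ΔH p) = Lap (phi p) := by
  simp only [ΔH, LinearMap.add_apply, LinearMap.comp_apply, map_add, phi_Xop, phi_Yop]
  generalize phi p = F
  simp only [map_add, map_sub, pderiv_mul, pderiv_C, pderiv_X_self,
    pderiv_X_of_ne n01, pderiv_X_of_ne n01.symm, pderiv_X_of_ne n02, pderiv_X_of_ne n12,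
    pd_comm 1 0, pd_comm 2 0, pd_comm 2 1, Lap]
  linear_combination (pderiv 0 (pderiv 0 F) - 2 * pderiv 0 (pderiv 1 F) + pderiv 1 (pderiv 1 F)
    + (X 0 - X 1) ^ 2 * pderiv 2 (pderiv 2 F)) * I2

lemma phi_eta : phi etaSq = X 0 * X 1 + 4 * X 2 := by
  simp only [etaSq, map_add, map_mul, map_pow, phi_X0, phi_X1, phi_X2, map_ofNat, hI]
  linear_combination (X 0 - X 1) ^ 2 * C (1/2 : ℂ) ^ 2 * I2 + (2 * C (1/2 : ℂ) + 1) * X 0 * X 1 * half2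

def psi : RC →ₐ[ℂ] RC := aeval ![X 0 + C Complex.I * X 1, X 0 - C Complex.I * X 1, X 2]
lemma psi_C (c : ℂ) : psi (C c) = C c := by rw [psi, aeval_C]; rfl
lemma psi_X0 : psi (X 0) = X 0 + C Complex.I * X 1 := by simp [psi]
lemma psi_X1 : psi (X 1) = X 0 - C Complex.I * X 1 := by simp [psi]
lemma psi_X2 : psi (X 2) = X 2 := by simp [psi]

lemma psi_phi (p : R3) : psi (phi p) = MvPolynomial.map Complex.ofRealHom p := by
  induction p using MvPolynomial.induction_on with
  | C r => rw [phi_C, psi_C, map_C]; rfl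
  | add p q hp hq => rw [map_add, map_add, hp, hq, map_add]
  | mul_X p i hp =>
    have e : psi (phi (X i)) = X i := by
      have h3 : i = 0 ∨ i = 1 ∨ i = 2 := by fin_cases i <;> simp
      rcases h3 with rfl | rfl | rfl
      · rw [phi_X0, map_mul, map_add, psi_C, psi_X0, psi_X1]
        linear_combination (X 0 : RC) * half2
      · rw [phi_X1, map_mul, map_sub, psi_C, psi_X0, psi_X1, hI]
        linear_combination (X 1 : RC) * half2 - 2 * C (1/2 : ℂ) * X 1 * I2
      · rw [phi_X2, psi_X2]
    rw [map_mul phi, map_mul psi, hp, e, map_mul (MvPolynomial.map Complex.ofRealHom), map_X]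

lemma phi_inj : Function.Injective phi := by
  intro p q hpq
  apply map_injective Complex.ofRealHom Complex.ofRealHom.injective
  rw [← psi_phi, ← psi_phi, hpq]

def m3 (a b c : ℕ) : Fin 3 →₀ ℕ := Finsupp.single 0 a + Finsupp.single 1 b + Finsupp.single 2 c
def cf (F : RC) (a b c : ℕ) : ℂ := coeff (m3 a b c) F

lemma m3_0 (a b c : ℕ) : m3 a b c + Finsupp.single 0 1 = m3 (a + 1) b c := by
  simp only [m3, Finsupp.single_add]; abel
lemma m3_1 (a b c : ℕ) : m3 a b c + Finsupp.single 1 1 = m3 a (b + 1) c := by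
  simp only [m3, Finsupp.single_add]; abel
lemma m3_2 (a b c : ℕ) : m3 a b c + Finsupp.single 2 1 = m3 a b (c + 1) := by
  simp only [m3, Finsupp.single_add]; abel
lemma m3_eq (d : Fin 3 →₀ ℕ) : m3 (d 0) (d 1) (d 2) = d := by
  ext i; fin_cases i <;> simp [m3]

lemma cf_add (F G : RC) (a b c : ℕ) : cf (F + G) a b c = cf F a b c + cf G a b c := coeff_add _ _ _
lemma cf_sub (F G : RC) (a b c : ℕ) : cf (F - G) a b c = cf F a b c - cf G a b c := coeff_sub _ _ _ _
lemma cf_C (z : ℂ) (G : RC) (a b c : ℕ) : cf (C z * G) a b c = z * cf G a b c := coeff_C_mul _ _ _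
lemma cf_4 (G : RC) (a b c : ℕ) : cf (4 * G) a b c = 4 * cf G a b c := by
  rw [← map_ofNat (C : ℂ →+* RC) 4, cf_C]
lemma cf_d0 (F : RC) (a b c : ℕ) : cf (pderiv 0 F) a b c = (a + 1) * cf F (a + 1) b c := by
  rw [cf, coeff_pderiv, m3_0, cf]; simp [m3, mul_comm]
lemma cf_d1 (F : RC) (a b c : ℕ) : cf (pderiv 1 F) a b c = (b + 1) * cf F a (b + 1) c := by
  rw [cf, coeff_pderiv, m3_1, cf]; simp [m3, mul_comm]
lemma cf_d2 (F : RC) (a b c : ℕ) : cf (pderiv 2 F) a b c = (c + 1) * cf F a b (c + 1) := by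
  rw [cf, coeff_pderiv, m3_2, cf]; simp [m3, mul_comm]
lemma cf_X0 (F : RC) (a b c : ℕ) : cf (X 0 * F) (a + 1) b c = cf F a b c := by
  rw [cf, ← m3_0, add_comm, coeff_X_mul, cf]
lemma cf_X1 (F : RC) (a b c : ℕ) : cf (X 1 * F) a (b + 1) c = cf F a b c := by
  rw [cf, ← m3_1, add_comm, coeff_X_mul, cf]
lemma cf_X2 (F : RC) (a b c : ℕ) : cf (X 2 * F) a b (c + 1) = cf F a b c := by
  rw [cf, ← m3_2, add_comm, coeff_X_mul, cf]
lemma cf_X0z (F : RC) (b c : ℕ) : cf (X 0 * F) 0 b c = 0 := by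
  rw [cf, coeff_X_mul']; simp [m3]
lemma cf_X1z (F : RC) (a c : ℕ) : cf (X 1 * F) a 0 c = 0 := by
  rw [cf, coeff_X_mul']; simp [m3]
lemma cf_X2z (F : RC) (a b : ℕ) : cf (X 2 * F) a b 0 = 0 := by
  rw [cf, coeff_X_mul']; simp [m3]
lemma cf_E0 (F : RC) (a b c : ℕ) : cf (X 0 * pderiv 0 F) a b c = a * cf F a b c := by
  rcases a with _ | a
  · simp [cf_X0z]
  · rw [cf_X0, cf_d0]; push_cast; ring
lemma cf_E1 (F : RC) (a b c : ℕ) : cf (X 1 * pderiv 1 F) a b c = b * cf F a b c := by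
  rcases b with _ | b
  · simp [cf_X1z]
  · rw [cf_X1, cf_d1]; push_cast; ring

lemma cf_lap (F : RC) (a b c : ℕ) : cf (Lap F) a b c =
    4 * ((a + 1) * (b + 1) * cf F (a + 1) (b + 1) c) -
    4 * Complex.I * (a - b) * (c + 1) * cf F a b (c + 1) +
    4 * cf (X 0 * (X 1 * pderiv 2 (pderiv 2 F))) a b c := by
  rw [Lap, cf_add, cf_sub, cf_4, cf_4, mul_assoc, cf_4, cf_C, cf_sub, cf_E0, cf_E1, cf_d0, cf_d1,
    cf_d2]
  ring

lemma inj (q : R3) (h : ΔH (etaSq * q) = 0) : q = 0 := by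
  have hL : Lap (phi (etaSq * q)) = 0 := by rw [← phi_lap, h, map_zero]
  have hF : phi (etaSq * q) = X 0 * (X 1 * phi q) + 4 * (X 2 * phi q) := by
    rw [map_mul, phi_eta]; ring
  have hz : phi (etaSq * q) = 0 := by
    generalize phi (etaSq * q) = F at *
    generalize phi q = Q at *
    have hl : ∀ a b c, cf (Lap F) a b c = 0 := fun a b c => by rw [hL]; exact coeff_zero _
    have hf : ∀ a b c, cf F a b c = cf (X 0 * (X 1 * Q)) a b c + 4 * cf (X 2 * Q) a b c :=
      fun a b c => by rw [hF, cf_add, cf_4]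
    ext d
    rw [coeff_zero, ← m3_eq d]
    change cf F (d 0) (d 1) (d 2) = 0
    generalize d 0 = a, d 1 = b, d 2 = c
    rcases le_total b a with hab | hab
    · obtain ⟨n, rfl⟩ := Nat.exists_eq_add_of_le' hab
      refine coreT n (fun j c => cf F (n + j) j c) (fun j c => cf Q (n + j) j c)
        ?_ ?_ ?_ ?_ ?_ ?_ b c
      · intro c
        have h1 := hl n 0 c
        rcases n with _ | n
        · rw [cf_lap, cf_X0z] at h1
          push_cast at h1 ⊢
          linear_combination (1/4) * h1
        · rw [cf_lap, cf_X0, cf_X1z] at h1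
          push_cast at h1 ⊢
          linear_combination (1/4) * h1
      · intro j c
        have h1 := hl (n + j + 1) (j + 1) c
        rw [cf_lap, cf_X0, cf_X1, cf_d2, cf_d2] at h1
        simp only [← add_assoc]
        push_cast at h1 ⊢
        linear_combination (1/4) * h1
      · beta_reduce
        rcases n with _ | n
        · rw [hf, cf_X0z, cf_X2z]; simp
        · rw [hf, add_zero, cf_X0, cf_X1z, cf_X2z]; simp
      · intro c
        beta_reduce
        rcases n with _ | n
        · rw [hf, cf_X0z, cf_X2]; simp
        · rw [hf, add_zero, cf_X0, cf_X1z, cf_X2]; simp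
      · intro j
        beta_reduce
        rw [hf, ← add_assoc, cf_X0, cf_X1, cf_X2z]; simp
      · intro j c
        beta_reduce
        rw [hf, ← add_assoc, cf_X0, cf_X1, cf_X2]
    · obtain ⟨n, rfl⟩ := Nat.exists_eq_add_of_le' hab
      rw [← map_eq_zero (starRingEnd ℂ)]
      refine coreT n (fun j c => starRingEnd ℂ (cf F j (n + j) c))
        (fun j c => starRingEnd ℂ (cf Q j (n + j) c)) ?_ ?_ ?_ ?_ ?_ ?_ a c
      · intro c
        have h1 := congrArg (starRingEnd ℂ) (hl 0 n c)
        rw [cf_lap, cf_X0z] at h1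
        simp only [map_add, map_sub, map_mul, map_natCast, map_ofNat, map_one, map_zero,
          Complex.conj_I, zero_add, Nat.cast_zero] at h1 ⊢
        linear_combination (1/4) * h1
      · intro j c
        have h1 := congrArg (starRingEnd ℂ) (hl (j + 1) (n + j + 1) c)
        rw [cf_lap, cf_X0, cf_X1, cf_d2, cf_d2] at h1
        simp only [← add_assoc]
        push_cast at h1
        simp only [map_add, map_sub, map_mul, map_natCast, map_ofNat, map_one, map_zero,
          Complex.conj_I] at h1 ⊢
        linear_combination (1/4) * h1
      · beta_reduce
        rw [hf, cf_X0z, cf_X2z]; simp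
      · intro c
        beta_reduce
        rw [hf, cf_X0z, cf_X2, zero_add, add_zero, map_mul, map_ofNat]
      · intro j
        beta_reduce
        rw [hf, ← add_assoc, cf_X0, cf_X1, cf_X2z]; simp
      · intro j c
        beta_reduce
        rw [hf, ← add_assoc, cf_X0, cf_X1, cf_X2, map_add, map_mul, map_ofNat]
  rw [map_mul] at hz
  rcases mul_eq_zero.mp hz with h0 | h0
  · exfalso
    have h1 : cf (phi etaSq) 0 0 1 = 4 := by
      rw [phi_eta, ← mul_one (X 2 : RC), cf_add, cf_X0z, cf_4,
        cf_X2]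
      simp [cf, m3]
    rw [h0] at h1
    simp [cf] at h1
  · exact phi_inj (by rw [h0, map_zero])

end HeisAux
namespace HeisAux

lemma w0 : w3 0 = 1 := rfl
lemma w1 : w3 1 = 1 := rfl
lemma w2 : w3 2 = 2 := rfl

lemma wt (d : Fin 3 →₀ ℕ) : Finsupp.weight w3 d = (d 0 + d 1 + 2 * d 2 : ℤ) := by
  rw [Finsupp.weight_apply, Finsupp.sum_fintype _ _ (by simp), Fin.sum_univ_three, w0, w1, w2]
  simp [mul_comm]

lemma mulX {p : R3} {m : ℤ} (hp : p ∈ Pm m) (i : Fin 3) : X i * p ∈ Pm (m + w3 i) := by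
  have := (isWeightedHomogeneous_X ℝ w3 i).mul ((mem_weightedHomogeneousSubmodule ℝ w3 m p).mp hp)
  rw [add_comm] at this
  exact this

lemma pd {p : R3} {m : ℤ} (hp : p ∈ Pm m) (i : Fin 3) : pderiv i p ∈ Pm (m - w3 i) :=
  IsWeightedHomogeneous.pderiv hp (by ring)

lemma two_mul_mem {p : R3} {m : ℤ} (hp : p ∈ Pm m) : 2 * p ∈ Pm m := by
  rw [two_mul]; exact add_mem hp hp

lemma mem_cast {p : R3} {m n : ℤ} (hp : p ∈ Pm m) (h : m = n) : p ∈ Pm n := h ▸ hp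

lemma Xop_mem {p : R3} {m : ℤ} (hp : p ∈ Pm m) : Xop p ∈ Pm (m - 1) := by
  have : Xop p = pderiv 0 p + 2 * (X 1 * pderiv 2 p) := by
    simp [Xop, mul_assoc]
  rw [this]
  refine add_mem (pd hp 0) (two_mul_mem (mem_cast (mulX (pd hp 2) 1) ?_))
  rw [w1, w2]; ring

lemma Yop_mem {p : R3} {m : ℤ} (hp : p ∈ Pm m) : Yop p ∈ Pm (m - 1) := by
  have : Yop p = pderiv 1 p - 2 * (X 0 * pderiv 2 p) := by
    simp [Yop, mul_assoc]
  rw [this]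
  refine sub_mem (pd hp 1) (two_mul_mem (mem_cast (mulX (pd hp 2) 0) ?_))
  rw [w0, w2]; ring

lemma lap_mem {p : R3} {m : ℤ} (hp : p ∈ Pm m) : ΔH p ∈ Pm (m - 2) :=
  add_mem (mem_cast (Xop_mem (Xop_mem hp)) (by ring)) (mem_cast (Yop_mem (Yop_mem hp)) (by ring))

lemma eta_mem {p : R3} {m : ℤ} (hp : p ∈ Pm m) : etaSq * p ∈ Pm (m + 2) := by
  have : etaSq * p = X 0 * (X 0 * p) + X 1 * (X 1 * p) + 2 * (2 * (X 2 * p)) := by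
    rw [etaSq]; ring
  rw [this]
  refine add_mem (add_mem (mem_cast (mulX (mulX hp 0) 0) ?_) (mem_cast (mulX (mulX hp 1) 1) ?_))
    (two_mul_mem (two_mul_mem (mulX hp 2)))
  · rw [w0]; ring
  · rw [w1]; ring

lemma neg_zero' {p : R3} {m : ℤ} (hp : p ∈ Pm m) (hm : m < 0) : p = 0 := by
  ext d
  rw [coeff_zero]
  by_contra h
  have := hp h
  rw [wt] at this
  omega

instance fin (m : ℤ) : Module.Finite ℝ (Pm m) := by
  have : Pm m ≤ restrictTotalDegree (Fin 3) ℝ m.toNat := by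
    intro p hp
    rw [mem_restrictTotalDegree]
    refine Finset.sup_le fun d hd => ?_
    have h := hp (mem_support_iff.mp hd)
    rw [wt] at h
    rw [Finsupp.sum_fintype _ _ (by simp), Fin.sum_univ_three]
    omega
  exact Submodule.finiteDimensional_of_le this

def Tm (m : ℤ) : Pm m →ₗ[ℝ] Pm m :=
  LinearMap.restrict (ΔH ∘ₗ LinearMap.mulLeft ℝ etaSq)
    (fun _ hp => mem_cast (lap_mem (eta_mem hp)) (by ring))

lemma surj {m : ℤ} {r : R3} (hr : r ∈ Pm m) : ∃ q ∈ Pm m, ΔH (etaSq * q) = r := by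
  have hi : Function.Injective (Tm m) := by
    rw [injective_iff_map_eq_zero]
    intro q hq
    have h1 := congrArg Subtype.val hq
    exact Subtype.ext (inj q.1 h1)
  obtain ⟨q, hq⟩ := LinearMap.injective_iff_surjective.mp hi ⟨r, hr⟩
  exact ⟨q.1, q.2, congrArg Subtype.val hq⟩

lemma exist (N : ℕ) : ∀ M : ℤ, M < 2 * N → ∀ p ∈ Pm M, ∃ h : ℕ → R3,
    (∀ j < N, h j ∈ Hm (M - 2 * j)) ∧ p = ∑ j ∈ Finset.range N, etaSq ^ j * h j := by
  induction N with
  | zero =>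
    intro M hM p hp
    exact ⟨0, by simp, by simpa using neg_zero' hp (by simpa using hM)⟩
  | succ N ih =>
    intro M hM p hp
    obtain ⟨q, hq, hqe⟩ := surj (lap_mem hp)
    obtain ⟨h, hh, he⟩ := ih (M - 2) (by push_cast at hM; linarith) q hq
    refine ⟨fun j => Nat.casesOn j (p - etaSq * q) h, ?_, ?_⟩
    · intro j hj
      rcases j with _ | j
      · refine ⟨?_, ?_⟩
        · exact mem_cast (sub_mem hp (mem_cast (eta_mem hq) (by ring))) (by simp)
        · change ΔH (p - etaSq * q) = 0
          rw [map_sub, hqe, sub_self]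
      · have := hh j (by omega)
        rwa [show M - 2 - 2 * (j : ℤ) = M - 2 * ((j + 1 : ℕ) : ℤ) by push_cast; ring] at this
    · rw [Finset.sum_range_succ']
      simp only [pow_zero, one_mul, pow_succ']
      simp only [mul_assoc, ← Finset.mul_sum]
      rw [← he]
      exact (add_sub_cancel _ _).symm

lemma uniq (N : ℕ) : ∀ h : ℕ → R3, (∀ j < N, ΔH (h j) = 0) →
    ∑ j ∈ Finset.range N, etaSq ^ j * h j = 0 → ∀ j < N, h j = 0 := by
  induction N with
  | zero => intro h _ _ j hj; omega
  | succ N ih =>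
    intro h hh hs
    rw [Finset.sum_range_succ'] at hs
    simp only [pow_zero, one_mul, pow_succ'] at hs
    simp only [mul_assoc, ← Finset.mul_sum] at hs
    have h1 : ∑ j ∈ Finset.range N, etaSq ^ j * h (j + 1) = 0 := by
      apply inj
      have h2 := congrArg ΔH hs
      rwa [map_add, hh 0 (by omega), add_zero, map_zero] at h2
    rw [h1, mul_zero, zero_add] at hs
    intro j hj
    rcases j with _ | j
    · exact hs
    · exact ih (fun j => h (j + 1)) (fun j hj => hh (j + 1) (by omega)) h1 j (by omega)

end HeisAux

/-- every `p ∈ P_m` has a unique representation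
`p = Σ_{j=0}^{⌊m/2⌋} (η₊²)^j h_j` with `h_j ∈ H_{m−2j}`. -/
theorem stmt1 (m : ℕ) :
    (∀ p ∈ Pm (m : ℤ), ∃ h : ℕ → R3,
        (∀ j ≤ m / 2, h j ∈ Hm ((m : ℤ) - 2 * j)) ∧
        p = ∑ j ∈ Finset.range (m / 2 + 1), etaSq ^ j * h j) ∧
    (∀ h h' : ℕ → R3,
        (∀ j ≤ m / 2, h j ∈ Hm ((m : ℤ) - 2 * j)) →
        (∀ j ≤ m / 2, h' j ∈ Hm ((m : ℤ) - 2 * j)) →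
        (∑ j ∈ Finset.range (m / 2 + 1), etaSq ^ j * h j =
          ∑ j ∈ Finset.range (m / 2 + 1), etaSq ^ j * h' j) →
        ∀ j ≤ m / 2, h j = h' j) := by
  constructor
  · intro p hp
    obtain ⟨h, hh, he⟩ := HeisAux.exist (m / 2 + 1) m (by push_cast; omega) p hp
    exact ⟨h, fun j hj => hh j (by omega), he⟩
  · intro h h' hh hh' he j hj
    have := HeisAux.uniq (m / 2 + 1) (fun j => h j - h' j) (fun j hj => by
      have h1 : ΔH (h j) = 0 := (hh j (by omega)).2
      have h2 : ΔH (h' j) = 0 := (hh' j (by omega)).2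
      simp only [map_sub, h1, h2, sub_self]) (by
      simp only [mul_sub, Finset.sum_sub_distrib, he, sub_self]) j (by omega)
    exact sub_eq_zero.mp this

end
end
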